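/- Let p ∈ (−n, 1), ε ∈ (0, 1/3), and let μ be a Borel measure on S^{n-1} with dμ = f dH^{n-1} where τ_1 < f < τ_2 for constants τ_2 > τ_1 > 0. Then both K ↦ ξ(K) and K ↦ Φ_ε(K, ξ(K)) are continuous on the space of convex bodies in ℝ^n equipped with the Hausdorff metric. -/

import Mathlib

open MeasureTheory Metric Set Filter
open scoped ENNReal RealInnerProductSpace NNReal

noncomputable section

abbrev Eu (n : ℕ) : Type := EuclideanSpace ℝ (Fin n)

def IsConvexBody {n : ℕ} (K : Set (Eu n)) : Prop :=
  Convex ℝ K ∧ IsCompact K ∧ (interior K).Nonempty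

def suppFn {n : ℕ} (K : Set (Eu n)) (u : Eu n) : ℝ :=
  sSup ((fun x => ⟪x, u⟫) '' K)

def IsOuterNormal {n : ℕ} (K : Set (Eu n)) (x u : Eu n) : Prop :=
  ‖u‖ = 1 ∧ ∀ y ∈ K, ⟪y, u⟫ ≤ ⟪x, u⟫

def gaussMap {n : ℕ} (K : Set (Eu n)) (x : Eu n) : Eu n :=
  open scoped Classical in
  if h : ∃ u, IsOuterNormal K x u then h.choose else 0

def lpSurf {n : ℕ} (p : ℝ) (K : Set (Eu n)) (ω : Set (Eu n)) : ℝ≥0∞ :=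
  ∫⁻ x in {x ∈ frontier K | gaussMap K x ∈ ω},
    ENNReal.ofReal (⟪x, gaussMap K x⟫ ^ (1 - p)) ∂(μH[(n:ℝ) - 1])


/-- The function `φ` of Section 3: `φ(t) = t^p` for `p ∈ (0,1)`, `log t` for `p = 0`, and
`-t^p` for `p ∈ (-n,0)`. -/
def phiFn (p : ℝ) (t : ℝ) : ℝ :=
  if 0 < p then t ^ p else if p = 0 then Real.log t else -(t ^ p)

/-- The modified energy density `φ_ε`: an increasing, strictly concave function on `(0,∞)`
with continuous negative second derivative that agrees with `φ` on `[3ε,∞)`, equals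
`-t^{-q}` on `(0,ε]`, and satisfies `φ_ε(t) ≥ -t^{-q}` on `(0,1)`. -/
def IsPhiEps (p ε q : ℝ) (φ : ℝ → ℝ) : Prop :=
  StrictMonoOn φ (Set.Ioi 0) ∧
  StrictConcaveOn ℝ (Set.Ioi 0) φ ∧
  (∀ t ∈ Set.Ioi (0:ℝ), DifferentiableAt ℝ φ t ∧ DifferentiableAt ℝ (deriv φ) t ∧
    deriv (deriv φ) t < 0) ∧
  ContinuousOn (deriv (deriv φ)) (Set.Ioi 0) ∧
  (∀ t : ℝ, 3 * ε ≤ t → φ t = phiFn p t) ∧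
  (∀ t : ℝ, 0 < t → t ≤ ε → φ t = -(t ^ (-q))) ∧
  (∀ t ∈ Set.Ioo (0:ℝ) 1, -(t ^ (-q)) ≤ φ t)

/-- The energy `Φ_ε(K, ξ) = ∫_{S^{n-1}} φ_ε (h_K(u) - ⟨u, ξ⟩) dμ(u)`. -/
def PhiE {n : ℕ} (μ : Measure (Eu n)) (φ : ℝ → ℝ) (K : Set (Eu n)) (ξ : Eu n) : ℝ :=
  ∫ u, φ (suppFn K u - ⟪u, ξ⟫) ∂μ


open Module in
lemma hausdorffMeasure_hemisphere_lt_top {m : ℕ} {v : Eu (m + 1)} (hv : ‖v‖ = 1) :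
    μH[(m : ℝ)] {x : Eu (m + 1) | ‖x‖ = 1 ∧ ⟪v, x⟫ ≤ 0} < ∞ := by
  have hfin : Fact (finrank ℝ (Eu (m + 1)) = m + 1) := ⟨by simp⟩
  have hV : finrank ℝ (ℝ ∙ v)ᗮ = m :=
    Submodule.finrank_orthogonal_span_singleton (norm_ne_zero_iff.1 (by simp [hv]))
  let F : (ℝ ∙ v)ᗮ → Eu (m + 1) := fun w => stereoInvFunAux v (w : Eu (m + 1))
  have hF : ContDiff ℝ 1 F := contDiff_stereoInvFunAux.comp (ℝ ∙ v)ᗮ.subtypeL.contDiff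
  obtain ⟨C, hC⟩ := hF.contDiffOn.exists_lipschitzOnWith (s := closedBall 0 2) one_ne_zero
    (convex_closedBall _ _) (isCompact_closedBall _ _)
  have hsub : {x : Eu (m + 1) | ‖x‖ = 1 ∧ ⟪v, x⟫ ≤ 0} ⊆ F '' closedBall 0 2 := by
    rintro x ⟨hx, hvx⟩
    refine ⟨stereoToFun v x, ?_, ?_⟩
    · rw [mem_closedBall_zero_iff, stereoToFun_apply, norm_smul, innerSL_apply_apply,
        Real.norm_eq_abs, abs_of_pos (by apply div_pos <;> linarith)]
      have h1 := (ℝ ∙ v)ᗮ.norm_orthogonalProjectionOnto_apply_le x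
      have h2 : 2 / (1 - ⟪v, x⟫) ≤ 2 := by
        rw [div_le_iff₀ (by linarith)]; linarith
      calc _ ≤ 2 * (1 : ℝ) := by gcongr; exact h1.trans hx.le
        _ = 2 := by norm_num
    · have hne : x ≠ v := by
        rintro rfl
        rw [real_inner_self_eq_norm_sq, hx] at hvx
        norm_num at hvx
      have := stereo_left_inv hv (x := ⟨x, by simp [hx]⟩) hne
      simpa [F] using congrArg Subtype.val this
  have hball : μH[(m : ℝ)] (closedBall (0 : (ℝ ∙ v)ᗮ) 2) < ∞ := by
    have := (isCompact_closedBall (0 : (ℝ ∙ v)ᗮ) 2).measure_lt_top (μ := μH[finrank ℝ (ℝ ∙ v)ᗮ])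
    rwa [hV] at this
  refine (measure_mono hsub).trans_lt ((hC.hausdorffMeasure_image_le (by positivity)).trans_lt ?_)
  exact ENNReal.mul_lt_top (ENNReal.rpow_lt_top_of_nonneg (by positivity) (by simp)) hball

lemma hausdorffMeasure_sphere_lt_top (m : ℕ) :
    μH[(m : ℝ)] (sphere (0 : Eu (m + 1)) 1) < ∞ := by
  let v : Eu (m + 1) := EuclideanSpace.single 0 1
  have hv : ‖v‖ = 1 := by simp [v]
  refine (measure_mono ?_).trans_lt ((measure_union_le _ _).trans_lt (ENNReal.add_lt_top.2
    ⟨hausdorffMeasure_hemisphere_lt_top hv,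
      hausdorffMeasure_hemisphere_lt_top (v := -v) (by simpa)⟩))
  intro x hx
  rw [mem_sphere_zero_iff_norm] at hx
  rcases le_total ⟪v, x⟫ 0 with h | h
  · exact Or.inl ⟨hx, h⟩
  · exact Or.inr ⟨hx, by rw [inner_neg_left]; linarith⟩

open Module in
lemma exists_le_hausdorffMeasure_closedBall_inter_sphere {m : ℕ} {v : Eu (m + 1)} (hv : ‖v‖ = 1) :
    ∃ c : ℝ, 0 < c ∧ ∀ r : ℝ, 0 ≤ r → r ≤ 1 →
      ENNReal.ofReal (c * r ^ m) ≤ μH[(m : ℝ)] (closedBall v r ∩ sphere (0 : Eu (m + 1)) 1) := by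
  have hfin : Fact (finrank ℝ (Eu (m + 1)) = m + 1) := ⟨by simp⟩
  have hV : finrank ℝ (ℝ ∙ v)ᗮ = m :=
    Submodule.finrank_orthogonal_span_singleton (norm_ne_zero_iff.1 (by simp [hv]))
  let ν : Measure (ℝ ∙ v)ᗮ := μH[finrank ℝ (ℝ ∙ v)ᗮ]
  have hν : ν = μH[(m : ℝ)] := by simp only [ν, hV]
  have hpos : 0 < ν (ball 0 1) := measure_ball_pos _ _ one_pos
  have hlt : ν (ball 0 1) < ∞ := measure_ball_lt_top
  refine ⟨(ν (ball 0 1)).toReal / 2 ^ m, div_pos (ENNReal.toReal_pos hpos.ne' hlt.ne) (by positivity),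
    fun r hr hr1 => ?_⟩
  have hsub : closedBall (0 : (ℝ ∙ v)ᗮ) (r / 2) ⊆
      (ℝ ∙ v)ᗮ.orthogonalProjectionOnto '' (closedBall v r ∩ sphere (0 : Eu (m + 1)) 1) := by
    intro y hy
    rw [mem_closedBall_zero_iff] at hy
    have hyv : ⟪(y : Eu (m + 1)), v⟫ = 0 :=
      Submodule.mem_orthogonal_singleton_iff_inner_left.1 y.2
    have hy0 : 0 ≤ ‖y‖ := norm_nonneg y
    set s := √(1 - ‖y‖ ^ 2) with hs
    have hs2 : s ^ 2 = 1 - ‖y‖ ^ 2 := Real.sq_sqrt (by nlinarith)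
    have hs0 : 0 ≤ s := Real.sqrt_nonneg _
    have hs1 : s ≤ 1 := by nlinarith
    refine ⟨(y : Eu (m + 1)) + s • v, ⟨?_, ?_⟩, ?_⟩
    · rw [mem_closedBall, dist_eq_norm, add_sub_assoc, show s • v - v = (s - 1) • v by rw [sub_smul, one_smul]]
      refine le_of_sq_le_sq ?_ hr
      rw [norm_add_sq_real, inner_smul_right, hyv, norm_smul, hv, Real.norm_eq_abs, mul_pow,
        sq_abs]
      change ‖y‖ ^ 2 + _ + _ ≤ _
      nlinarith
    · rw [mem_sphere_zero_iff_norm]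
      have : ‖(y : Eu (m + 1)) + s • v‖ ^ 2 = 1 := by
        rw [norm_add_sq_real, inner_smul_right, hyv, norm_smul, hv, Real.norm_eq_abs, mul_pow,
          sq_abs, hs2]
        simp
      nlinarith [norm_nonneg ((y : Eu (m + 1)) + s • v)]
    · rw [map_add, map_smul, Submodule.orthogonalProjectionOnto_mem_subspace_eq_self,
        Submodule.orthogonalProjectionOnto_orthogonal_apply_eq_zero]
      · simp
      · exact Submodule.mem_span_singleton_self v
  calc ENNReal.ofReal ((ν (ball 0 1)).toReal / 2 ^ m * r ^ m)
      = ν (closedBall 0 (r / 2)) := by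
        rw [Measure.addHaar_closedBall _ _ (by positivity), hV, div_mul_eq_mul_div, mul_div_assoc,
          ← div_pow, mul_comm, ENNReal.ofReal_mul (by positivity), ENNReal.ofReal_toReal hlt.ne]
    _ = μH[(m : ℝ)] (closedBall (0 : (ℝ ∙ v)ᗮ) (r / 2)) := by rw [hν]
    _ ≤ _ := measure_mono hsub
    _ ≤ _ := hausdorffMeasure_orthogonalProjectionOnto_le _ _ _ (by positivity)

lemma isFiniteMeasure_withDensity_sphere {m : ℕ} {f : Eu (m + 1) → ℝ} {τ : ℝ}
    (hf : ∀ u ∈ sphere (0 : Eu (m + 1)) 1, f u ≤ τ) :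
    IsFiniteMeasure (((μH[(m : ℝ)]).restrict (sphere (0 : Eu (m + 1)) 1)).withDensity
      fun u => ENNReal.ofReal (f u)) := by
  refine ⟨?_⟩
  rw [withDensity_apply _ MeasurableSet.univ, Measure.restrict_univ]
  calc ∫⁻ u in sphere (0 : Eu (m + 1)) 1, ENNReal.ofReal (f u) ∂μH[(m : ℝ)]
      ≤ ∫⁻ _ in sphere (0 : Eu (m + 1)) 1, ENNReal.ofReal τ ∂μH[(m : ℝ)] :=
        setLIntegral_mono measurable_const fun u hu => ENNReal.ofReal_le_ofReal (hf u hu)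
    _ = ENNReal.ofReal τ * μH[(m : ℝ)] (sphere (0 : Eu (m + 1)) 1) := setLIntegral_const _ _
    _ < ∞ := ENNReal.mul_lt_top ENNReal.ofReal_lt_top (hausdorffMeasure_sphere_lt_top m)

lemma exists_le_withDensity_closedBall {m : ℕ} {f : Eu (m + 1) → ℝ} {τ : ℝ} (hτ : 0 < τ)
    (hf : ∀ u ∈ sphere (0 : Eu (m + 1)) 1, τ ≤ f u) {v : Eu (m + 1)} (hv : ‖v‖ = 1) :
    ∃ c : ℝ, 0 < c ∧ ∀ r : ℝ, 0 ≤ r → r ≤ 1 → ENNReal.ofReal (c * r ^ m) ≤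
      ((μH[(m : ℝ)]).restrict (sphere (0 : Eu (m + 1)) 1)).withDensity
        (fun u => ENNReal.ofReal (f u)) (closedBall v r) := by
  obtain ⟨c, hc, h⟩ := exists_le_hausdorffMeasure_closedBall_inter_sphere hv
  refine ⟨τ * c, mul_pos hτ hc, fun r hr hr1 => ?_⟩
  have hmeas : MeasurableSet (closedBall v r) := isClosed_closedBall.measurableSet
  rw [withDensity_apply _ hmeas, Measure.restrict_restrict hmeas]
  calc ENNReal.ofReal (τ * c * r ^ m)
      = ENNReal.ofReal τ * ENNReal.ofReal (c * r ^ m) := by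
        rw [mul_assoc, ENNReal.ofReal_mul hτ.le]
    _ ≤ ENNReal.ofReal τ * μH[(m : ℝ)] (closedBall v r ∩ sphere 0 1) := by
        gcongr
        exact h r hr hr1
    _ = ∫⁻ _ in closedBall v r ∩ sphere 0 1, ENNReal.ofReal τ ∂μH[(m : ℝ)] :=
        (setLIntegral_const _ _).symm
    _ ≤ ∫⁻ u in closedBall v r ∩ sphere 0 1, ENNReal.ofReal (f u) ∂μH[(m : ℝ)] :=
        setLIntegral_mono' (hmeas.inter isClosed_sphere.measurableSet)
          fun u hu => ENNReal.ofReal_le_ofReal (hf u hu.2)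

lemma bddAbove_inner_image {n : ℕ} {K : Set (Eu n)} (hK : IsCompact K) (u : Eu n) :
    BddAbove ((fun x => ⟪x, u⟫) '' K) :=
  (hK.image (by fun_prop)).bddAbove

lemma inner_le_suppFn {n : ℕ} {K : Set (Eu n)} (hK : IsCompact K) {x : Eu n} (hx : x ∈ K)
    (u : Eu n) : ⟪x, u⟫ ≤ suppFn K u :=
  le_csSup (bddAbove_inner_image hK u) (mem_image_of_mem _ hx)

lemma suppFn_le {n : ℕ} {K : Set (Eu n)} (hne : K.Nonempty) {u : Eu n} {c : ℝ}
    (h : ∀ x ∈ K, ⟪x, u⟫ ≤ c) : suppFn K u ≤ c :=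
  csSup_le (hne.image _) (forall_mem_image.2 h)

lemma exists_lipschitzWith_suppFn {n : ℕ} {K : Set (Eu n)} (hK : IsCompact K) (hne : K.Nonempty) :
    ∃ R : ℝ≥0, LipschitzWith R (suppFn K) := by
  obtain ⟨R, hR⟩ := hK.isBounded.exists_norm_le
  refine ⟨R.toNNReal, LipschitzWith.of_le_add_mul _ fun u w => suppFn_le hne fun x hx => ?_⟩
  have h1 : ⟪x, u - w⟫ ≤ R.toNNReal * ‖u - w‖ :=
    (real_inner_le_norm _ _).trans
      (mul_le_mul_of_nonneg_right ((hR x hx).trans (Real.le_coe_toNNReal R)) (norm_nonneg _))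
  rw [inner_sub_right] at h1
  rw [dist_eq_norm]
  linarith [inner_le_suppFn hK hx w]

lemma suppFn_le_add_hausdorffDist {n : ℕ} {K L : Set (Eu n)} (hK : IsCompact K)
    (hKne : K.Nonempty) (hL : IsCompact L) (hLne : L.Nonempty) {u : Eu n} (hu : ‖u‖ = 1) :
    suppFn K u ≤ suppFn L u + hausdorffDist K L := by
  refine suppFn_le hKne fun x hx => le_of_forall_pos_le_add fun δ hδ => ?_
  obtain ⟨y, hy, hxy⟩ := exists_dist_lt_of_hausdorffDist_lt hx (lt_add_of_pos_right _ hδ)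
    (hausdorffEDist_ne_top_of_nonempty_of_bounded hKne hLne hK.isBounded hL.isBounded)
  have h1 := real_inner_le_norm (x - y) u
  rw [inner_sub_left, hu, mul_one, ← dist_eq_norm] at h1
  linarith [inner_le_suppFn hL hy u]

lemma mem_interior_of_forall_le_suppFn_sub {n : ℕ} {K : Set (Eu n)} (hconv : Convex ℝ K)
    (hK : IsCompact K) (hne : K.Nonempty) {x : Eu n} {δ : ℝ} (hδ : 0 < δ)
    (h : ∀ u : Eu n, ‖u‖ = 1 → δ ≤ suppFn K u - ⟪u, x⟫) : x ∈ interior K := by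
  refine mem_interior.2 ⟨ball x δ, fun y hy => ?_, isOpen_ball, mem_ball_self hδ⟩
  by_contra hyK
  obtain ⟨f, s, hf, hs⟩ := geometric_hahn_banach_closed_point hconv hK.isClosed hyK
  set w := (InnerProductSpace.toDual ℝ (Eu n)).symm f with hw
  have hfw : ∀ z, f z = ⟪z, w⟫ := fun z => by
    rw [real_inner_comm, hw, InnerProductSpace.toDual_symm_apply]
  have hw0 : w ≠ 0 := by
    intro h0
    obtain ⟨z, hz⟩ := hne
    have h1 := hf z hz
    rw [hfw, h0, inner_zero_right] at h1 hs
    linarith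
  have hwp : 0 < ‖w‖ := norm_pos_iff.2 hw0
  have hu : ‖‖w‖⁻¹ • w‖ = 1 := by simp [norm_smul, hw0]
  have h1 : suppFn K (‖w‖⁻¹ • w) ≤ ⟪y, ‖w‖⁻¹ • w⟫ := suppFn_le hne fun z hz => by
    rw [inner_smul_right, inner_smul_right, ← hfw, ← hfw]
    exact mul_le_mul_of_nonneg_left ((hf z hz).trans hs).le (by positivity)
  have h2 := h _ hu
  have h3 := real_inner_le_norm (y - x) (‖w‖⁻¹ • w)
  rw [inner_sub_left, hu, mul_one, ← dist_eq_norm] at h3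
  rw [real_inner_comm] at h2
  linarith [mem_ball.1 hy]

lemma exists_forall_le_suppFn_sub {n : ℕ} {K : Set (Eu n)} (hK : IsCompact K) {x : Eu n}
    (hx : x ∈ interior K) : ∃ δ > 0, ∀ u : Eu n, ‖u‖ = 1 → δ ≤ suppFn K u - ⟪u, x⟫ := by
  obtain ⟨δ, hδ, hb⟩ := nhds_basis_closedBall.mem_iff.1 (mem_interior_iff_mem_nhds.1 hx)
  refine ⟨δ, hδ, fun u hu => ?_⟩
  have hmem : x + δ • u ∈ K := hb (by simp [norm_smul, hu, abs_of_pos hδ])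
  have h1 := inner_le_suppFn hK hmem u
  rw [inner_add_left, real_inner_smul_left, real_inner_self_eq_norm_sq, hu, real_inner_comm] at h1
  linarith

lemma exists_suppFn_eq_inner {m : ℕ} {K : Set (Eu (m + 1))} (hK : IsConvexBody K)
    {x : Eu (m + 1)} (hx : x ∈ K) (hxi : x ∉ interior K) :
    ∃ u : Eu (m + 1), ‖u‖ = 1 ∧ suppFn K u = ⟪u, x⟫ := by
  obtain ⟨hconv, hc, -⟩ := hK
  obtain ⟨R, hR⟩ := exists_lipschitzWith_suppFn hc ⟨x, hx⟩
  obtain ⟨u, hu, hmin⟩ := (isCompact_sphere (0 : Eu (m + 1)) 1).exists_isMinOn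
    (NormedSpace.sphere_nonempty.2 zero_le_one)
    (f := fun u => suppFn K u - ⟪u, x⟫)
    ((hR.continuous.sub (by fun_prop)).continuousOn)
  have hnn : 0 ≤ suppFn K u - ⟪u, x⟫ := by
    rw [real_inner_comm]
    exact sub_nonneg.2 (inner_le_suppFn hc hx u)
  refine ⟨u, mem_sphere_zero_iff_norm.1 hu, ?_⟩
  by_contra hne
  refine hxi (mem_interior_of_forall_le_suppFn_sub hconv hc ⟨x, hx⟩
    (hnn.lt_of_ne fun h => hne (sub_eq_zero.1 h.symm)) fun w hw => ?_)
  exact hmin (mem_sphere_zero_iff_norm.2 hw)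

lemma IsConvexBody.nonempty {n : ℕ} {K : Set (Eu n)} (hK : IsConvexBody K) : K.Nonempty :=
  hK.2.2.mono interior_subset

lemma IsConvexBody.continuous_suppFn_sub {n : ℕ} {K : Set (Eu n)} (hK : IsConvexBody K)
    (x : Eu n) : Continuous fun u => suppFn K u - ⟪u, x⟫ := by
  obtain ⟨R, hR⟩ := exists_lipschitzWith_suppFn hK.2.1 hK.nonempty
  exact hR.continuous.sub (by fun_prop)

lemma IsConvexBody.suppFn_sub_pos {n : ℕ} {K : Set (Eu n)} (hK : IsConvexBody K) {x u : Eu n}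
    (hx : x ∈ interior K) (hu : ‖u‖ = 1) : 0 < suppFn K u - ⟪u, x⟫ := by
  obtain ⟨δ, hδ, h⟩ := exists_forall_le_suppFn_sub hK.2.1 hx
  exact hδ.trans_le (h u hu)

lemma IsConvexBody.abs_suppFn_sub_sub_le {n : ℕ} {K L : Set (Eu n)} (hK : IsConvexBody K)
    (hL : IsConvexBody L) (ξ x : Eu n) {u : Eu n} (hu : ‖u‖ = 1) :
    |(suppFn L u - ⟪u, ξ⟫) - (suppFn K u - ⟪u, x⟫)| ≤ hausdorffDist L K + dist ξ x := by
  have h1 := suppFn_le_add_hausdorffDist hL.2.1 hL.nonempty hK.2.1 hK.nonempty hu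
  have h2 := suppFn_le_add_hausdorffDist hK.2.1 hK.nonempty hL.2.1 hL.nonempty hu
  rw [hausdorffDist_comm] at h2
  have h3 := abs_real_inner_le_norm u (ξ - x)
  rw [inner_sub_right, hu, one_mul, ← dist_eq_norm, abs_le] at h3
  rw [abs_le]
  constructor <;> linarith [h3.1, h3.2]

lemma IsConvexBody.integrable_comp_suppFn_sub {n : ℕ} {μ : Measure (Eu n)} [IsFiniteMeasure μ]
    (hμS : ∀ᵐ u ∂μ, u ∈ sphere (0 : Eu n) 1) {φ : ℝ → ℝ} (hφ : ContinuousOn φ (Ioi 0))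
    {K : Set (Eu n)} (hK : IsConvexBody K) {x : Eu n} (hx : x ∈ interior K) :
    Integrable (fun u => φ (suppFn K u - ⟪u, x⟫)) μ := by
  have : ContinuousOn (fun u => φ (suppFn K u - ⟪u, x⟫)) (sphere 0 1) :=
    hφ.comp (hK.continuous_suppFn_sub x).continuousOn fun u hu =>
      hK.suppFn_sub_pos hx (mem_sphere_zero_iff_norm.1 hu)
  have h2 := this.integrableOn_compact (μ := μ) (isCompact_sphere _ _)
  rwa [IntegrableOn, Measure.restrict_eq_self_of_ae_mem hμS] at h2

lemma IsConvexBody.exists_suppFn_sub_le {n : ℕ} {K : Set (Eu n)} (hK : IsConvexBody K)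
    (x : Eu n) : ∃ C, ∀ u : Eu n, ‖u‖ = 1 → suppFn K u - ⟪u, x⟫ ≤ C := by
  obtain ⟨C, hC⟩ := ((isCompact_sphere (0 : Eu n) 1).image
    (hK.continuous_suppFn_sub x)).bddAbove
  exact ⟨C, fun u hu => hC (mem_image_of_mem _ (mem_sphere_zero_iff_norm.2 hu))⟩

lemma tendsto_PhiE {n : ℕ} {μ : Measure (Eu n)} [IsFiniteMeasure μ]
    (hμS : ∀ᵐ u ∂μ, u ∈ sphere (0 : Eu n) 1) {φ : ℝ → ℝ} (hφ : ContinuousOn φ (Ioi 0))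
    (hmono : MonotoneOn φ (Ioi 0)) {Km : ℕ → Set (Eu n)} {K : Set (Eu n)}
    (hKm : ∀ m, IsConvexBody (Km m)) (hK : IsConvexBody K)
    (hd : Tendsto (fun m => hausdorffDist (Km m) K) atTop (nhds 0))
    {ξ : ℕ → Eu n} {x : Eu n} (hξ : Tendsto ξ atTop (nhds x)) (hx : x ∈ interior K) :
    (∀ᶠ m in atTop, ξ m ∈ interior (Km m)) ∧
      Tendsto (fun m => PhiE μ φ (Km m) (ξ m)) atTop (nhds (PhiE μ φ K x)) := by
  obtain ⟨δ, hδ, hδK⟩ := exists_forall_le_suppFn_sub hK.2.1 hx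
  obtain ⟨C, hC⟩ := hK.exists_suppFn_sub_le x
  have he : Tendsto (fun m => hausdorffDist (Km m) K + dist (ξ m) x) atTop (nhds 0) := by
    simpa using hd.add (tendsto_iff_dist_tendsto_zero.1 hξ)
  have hev : ∀ᶠ m in atTop, ∀ u : Eu n, ‖u‖ = 1 →
      δ / 2 ≤ suppFn (Km m) u - ⟪u, ξ m⟫ ∧ suppFn (Km m) u - ⟪u, ξ m⟫ ≤ C + δ := by
    filter_upwards [he.eventually (gt_mem_nhds (half_pos hδ))] with m hm u hu
    have h1 := abs_le.1 (hK.abs_suppFn_sub_sub_le (hKm m) (ξ m) x hu)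
    have h2 := hδK u hu
    have h3 := hC u hu
    constructor <;> linarith [h1.1, h1.2]
  have hint : ∀ᶠ m in atTop, ξ m ∈ interior (Km m) := by
    filter_upwards [hev] with m hm
    exact mem_interior_of_forall_le_suppFn_sub (hKm m).1 (hKm m).2.1 (hKm m).nonempty
      (half_pos hδ) fun u hu => (hm u hu).1
  refine ⟨hint, tendsto_integral_filter_of_dominated_convergence
    (fun _ => max |φ (δ / 2)| |φ (C + δ)|) ?_ ?_ (integrable_const _) ?_⟩
  · filter_upwards [hint] with m hm
    exact ((hKm m).integrable_comp_suppFn_sub hμS hφ hm).aestronglyMeasurable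
  · filter_upwards [hev] with m hm
    filter_upwards [hμS] with u hu
    obtain ⟨h1, h2⟩ := hm u (mem_sphere_zero_iff_norm.1 hu)
    have hpos : 0 < suppFn (Km m) u - ⟪u, ξ m⟫ := (half_pos hδ).trans_le h1
    exact abs_le_max_abs_abs (hmono (half_pos hδ) hpos h1) (hmono hpos (hpos.trans_le h2) h2)
  · filter_upwards [hμS] with u hu
    rw [mem_sphere_zero_iff_norm] at hu
    have hg : Tendsto (fun m => suppFn (Km m) u - ⟪u, ξ m⟫) atTop
        (nhds (suppFn K u - ⟪u, x⟫)) := by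
      rw [tendsto_iff_dist_tendsto_zero]
      exact squeeze_zero (fun _ => dist_nonneg)
        (fun m => hK.abs_suppFn_sub_sub_le (hKm m) (ξ m) x hu) he
    exact (hφ.continuousAt (Ioi_mem_nhds (hK.suppFn_sub_pos hx hu))).tendsto.comp hg

lemma eq_of_isMax_PhiE {m : ℕ} {μ : Measure (Eu (m + 1))} [IsFiniteMeasure μ]
    (hμS : ∀ᵐ u ∂μ, u ∈ sphere (0 : Eu (m + 1)) 1)
    (hμpos : ∀ v : Eu (m + 1), ‖v‖ = 1 → 0 < μ (closedBall v (1 / 2)))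
    {φ : ℝ → ℝ} (hφ : ContinuousOn φ (Ioi 0)) (hconc : StrictConcaveOn ℝ (Ioi 0) φ)
    {K : Set (Eu (m + 1))} (hK : IsConvexBody K) {x y : Eu (m + 1)} (hx : x ∈ interior K)
    (hy : y ∈ interior K) (hxy : PhiE μ φ K y ≤ PhiE μ φ K x)
    (hmax : ∀ z ∈ interior K, PhiE μ φ K z ≤ PhiE μ φ K y) : x = y := by
  by_contra hne
  set z := (1 / 2 : ℝ) • x + (1 / 2 : ℝ) • y with hz
  have hzK : z ∈ interior K :=
    hK.1.interior hx hy (by norm_num) (by norm_num) (by norm_num)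
  let g : Eu (m + 1) → Eu (m + 1) → ℝ := fun w u => suppFn K u - ⟪u, w⟫
  have hgz : ∀ u, g z u = (1 / 2 : ℝ) • g x u + (1 / 2 : ℝ) • g y u := fun u => by
    simp only [g, hz, inner_add_right, inner_smul_right, smul_eq_mul]
    ring
  have hi : ∀ w ∈ interior K, Integrable (fun u => φ (g w u)) μ := fun w hw =>
    hK.integrable_comp_suppFn_sub hμS hφ hw
  let D : Eu (m + 1) → ℝ := fun u =>
    φ (g z u) - ((1 / 2 : ℝ) * φ (g x u) + (1 / 2 : ℝ) * φ (g y u))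
  have hD0 : 0 ≤ᵐ[μ] D := by
    filter_upwards [hμS] with u hu
    rw [mem_sphere_zero_iff_norm] at hu
    have := hconc.concaveOn.2 (hK.suppFn_sub_pos hx hu) (hK.suppFn_sub_pos hy hu)
      (by norm_num : (0 : ℝ) ≤ 1 / 2) (by norm_num : (0 : ℝ) ≤ 1 / 2) (by norm_num)
    simp only [D, hgz, Pi.zero_apply, sub_nonneg]
    exact this
  have hs : Integrable (fun u => (1 / 2 : ℝ) * φ (g x u) + (1 / 2 : ℝ) * φ (g y u)) μ :=
    ((hi x hx).const_mul _).add ((hi y hy).const_mul _)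
  have hDi : Integrable D μ := (hi z hzK).sub hs
  have hDint : ∫ u, D u ∂μ = PhiE μ φ K z - (1 / 2 * PhiE μ φ K x + 1 / 2 * PhiE μ φ K y) := by
    simp only [D]
    rw [integral_sub (hi z hzK) hs, integral_add ((hi x hx).const_mul _) ((hi y hy).const_mul _),
      integral_const_mul, integral_const_mul]
    rfl
  have hDz : ∫ u, D u ∂μ = 0 := by
    refine le_antisymm ?_ (integral_nonneg_of_ae hD0)
    rw [hDint]
    linarith [hmax z hzK]
  rw [integral_eq_zero_iff_of_nonneg_ae hD0 hDi] at hDz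
  have hw : 0 < ‖x - y‖ := norm_pos_iff.2 (sub_ne_zero.2 hne)
  set v := ‖x - y‖⁻¹ • (x - y) with hv
  have hv1 : ‖v‖ = 1 := by rw [hv, norm_smul, norm_inv, norm_norm, inv_mul_cancel₀ hw.ne']
  obtain ⟨u, hu, hu1, hu2⟩ :=
    Measure.exists_mem_of_measure_ne_zero_of_ae (hμpos v hv1).ne' (ae_restrict_of_ae (hμS.and hDz))
  rw [mem_sphere_zero_iff_norm] at hu1
  have huv : 0 < ⟪u, v⟫ := by
    have h1 := abs_real_inner_le_norm (u - v) v
    rw [mem_closedBall, dist_eq_norm] at hu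
    rw [inner_sub_left, real_inner_self_eq_norm_sq, hv1, abs_le] at h1
    linarith [h1.1]
  have hgne : g x u ≠ g y u := by
    intro h
    have : ⟪u, x - y⟫ = 0 := by
      rw [inner_sub_right]
      simp only [g] at h
      linarith
    rw [hv, inner_smul_right, this, mul_zero] at huv
    exact huv.false
  have := hconc.2 (hK.suppFn_sub_pos hx hu1) (hK.suppFn_sub_pos hy hu1) hgne
      (by norm_num : (0 : ℝ) < 1 / 2) (by norm_num : (0 : ℝ) < 1 / 2) (by norm_num)
  simp only [D, hgz, Pi.zero_apply, sub_eq_zero] at hu2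
  exact this.ne' hu2

lemma lintegral_rpow_neg_dist_eq_top {X : Type*} [MetricSpace X] [MeasurableSpace X]
    [BorelSpace X] {μ : Measure X} [IsFiniteMeasure μ] {v : X} {c R q : ℝ}
    {m : ℕ} (hc : 0 < c) (hR : 0 < R) (hq : 0 < q) (hmq : (m : ℝ) ≤ q)
    (hμ : ∀ r : ℝ, 0 ≤ r → r ≤ 1 → ENNReal.ofReal (c * r ^ m) ≤ μ (closedBall v r)) :
    ∫⁻ u, ENNReal.ofReal (R * dist u v) ^ (-q) ∂μ = ∞ := by
  by_contra hfin
  have hmeas : Measurable fun u => ENNReal.ofReal (R * dist u v) ^ (-q) :=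
    (ENNReal.continuous_rpow_const.comp
      (ENNReal.continuous_ofReal.comp (by fun_prop))).measurable
  have hsing : μ {v} = 0 := by
    refine measure_mono_null ?_ (measure_eq_top_of_lintegral_ne_top hmeas.aemeasurable hfin)
    rintro u rfl
    simp [hq]
  let r : ℕ → ℝ := fun k => 1 / ((k : ℝ) + 1)
  have hr0 : ∀ k, 0 < r k := fun k => Nat.one_div_pos_of_nat
  have hr1 : ∀ k, r k ≤ 1 := fun k => by
    simp only [r]
    rw [div_le_one (by positivity)]
    linarith [k.cast_nonneg (α := ℝ)]
  have hinter : ⋂ k, closedBall v (r k) = {v} := by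
    ext u
    simp only [mem_iInter, mem_closedBall, mem_singleton_iff]
    refine ⟨fun h => dist_le_zero.1 ?_, fun h k => by simp [h, (hr0 k).le]⟩
    exact ge_of_tendsto' tendsto_one_div_add_atTop_nhds_zero_nat h
  have hlim : Tendsto (μ ∘ fun k => closedBall v (r k)) atTop (nhds 0) := by
    rw [← hsing, ← hinter]
    exact tendsto_measure_iInter_atTop (fun k => isClosed_closedBall.nullMeasurableSet)
      (fun i j hij => closedBall_subset_closedBall (Nat.one_div_le_one_div hij))
      ⟨0, measure_ne_top _ _⟩
  have hint := tendsto_setLIntegral_zero hfin hlim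
  have hlow : ∀ k, ENNReal.ofReal (R ^ (-q) * c) ≤
      ∫⁻ u in closedBall v (r k), ENNReal.ofReal (R * dist u v) ^ (-q) ∂μ := fun k => by
    have hrk := hr0 k
    calc ENNReal.ofReal (R ^ (-q) * c)
        ≤ ENNReal.ofReal ((R * r k) ^ (-q) * (c * r k ^ m)) := by
          refine ENNReal.ofReal_le_ofReal ?_
          rw [Real.mul_rpow hR.le hrk.le, mul_mul_mul_comm, mul_right_comm]
          have h1 : 1 ≤ r k ^ (-q) * r k ^ m := by
            rw [← Real.rpow_natCast, ← Real.rpow_add hrk]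
            exact Real.one_le_rpow_of_pos_of_le_one_of_nonpos hrk (hr1 k) (by linarith)
          have h2 : 0 < R ^ (-q) * c := mul_pos (Real.rpow_pos_of_pos hR _) hc
          calc R ^ (-q) * c ≤ R ^ (-q) * c * (r k ^ (-q) * r k ^ m) :=
                le_mul_of_one_le_right h2.le h1
            _ = _ := by ring
      _ = ENNReal.ofReal (R * r k) ^ (-q) * ENNReal.ofReal (c * r k ^ m) := by
          rw [ENNReal.ofReal_mul (by positivity), ENNReal.ofReal_rpow_of_pos (by positivity)]
      _ ≤ ENNReal.ofReal (R * r k) ^ (-q) * μ (closedBall v (r k)) := by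
          gcongr
          exact hμ _ hrk.le (hr1 k)
      _ = ∫⁻ u in closedBall v (r k), ENNReal.ofReal (R * r k) ^ (-q) ∂μ := by
          rw [setLIntegral_const]
      _ ≤ _ := by
          refine setLIntegral_mono hmeas fun u hu => ?_
          rw [ENNReal.rpow_neg, ENNReal.rpow_neg]
          gcongr
          exact hu
  have := ge_of_tendsto' hint hlow
  rw [nonpos_iff_eq_zero, ENNReal.ofReal_eq_zero] at this
  exact this.not_gt (mul_pos (Real.rpow_pos_of_pos hR _) hc)

lemma mem_interior_of_tendsto_of_le_PhiE {m : ℕ} {μ : Measure (Eu (m + 1))} [IsFiniteMeasure μ]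
    (hμS : ∀ᵐ u ∂μ, u ∈ sphere (0 : Eu (m + 1)) 1)
    (hμ : ∀ v : Eu (m + 1), ‖v‖ = 1 → ∃ c : ℝ, 0 < c ∧ ∀ r : ℝ, 0 ≤ r → r ≤ 1 →
      ENNReal.ofReal (c * r ^ m) ≤ μ (closedBall v r))
    {φ : ℝ → ℝ} (hφ : ContinuousOn φ (Ioi 0)) (hmono : MonotoneOn φ (Ioi 0)) {ε q : ℝ}
    (hε : 0 < ε) (hq : 0 < q) (hmq : (m : ℝ) ≤ q)
    (hφε : ∀ t : ℝ, 0 < t → t ≤ ε → φ t = -(t ^ (-q)))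
    {Km : ℕ → Set (Eu (m + 1))} {K : Set (Eu (m + 1))}
    (hKm : ∀ k, IsConvexBody (Km k)) (hK : IsConvexBody K)
    (hd : Tendsto (fun k => hausdorffDist (Km k) K) atTop (nhds 0))
    {ξ : ℕ → Eu (m + 1)} (hξm : ∀ k, ξ k ∈ interior (Km k)) {x : Eu (m + 1)}
    (hξ : Tendsto ξ atTop (nhds x)) (hx : x ∈ K) {M : ℝ}
    (hM : ∀ᶠ k in atTop, M ≤ PhiE μ φ (Km k) (ξ k)) : x ∈ interior K := by
  by_contra hxi
  obtain ⟨v, hv, hvx⟩ := exists_suppFn_eq_inner hK hx hxi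
  obtain ⟨c, hc, hcμ⟩ := hμ v hv
  obtain ⟨R₀, hR₀⟩ := exists_lipschitzWith_suppFn hK.2.1 hK.nonempty
  obtain ⟨C₀, hC₀⟩ := hK.exists_suppFn_sub_le x
  set e : ℕ → ℝ := fun k => hausdorffDist (Km k) K + dist (ξ k) x with he_def
  have he : Tendsto e atTop (nhds 0) := by
    simpa using hd.add (tendsto_iff_dist_tendsto_zero.1 hξ)
  set R : ℝ := R₀ + ‖x‖ + 1 with hR_def
  have hR : 0 < R := by positivity
  have hgR : ∀ u : Eu (m + 1), suppFn K u - ⟪u, x⟫ ≤ R * dist u v := fun u => by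
    have h1 := (le_abs_self _).trans (hR₀.dist_le_mul u v)
    have h2 := abs_le.1 (abs_real_inner_le_norm (u - v) x)
    rw [inner_sub_left, ← dist_eq_norm] at h2
    have h3 := dist_nonneg (x := u) (y := v)
    rw [hR_def, add_mul, add_mul]
    linarith [h2.1]
  set C := max (C₀ + 1) ε with hC_def
  have hC : 0 < C := hε.trans_le (le_max_right _ _)
  have hCε : -(ε ^ (-q)) ≤ φ C := by
    rw [← hφε ε hε le_rfl]
    exact hmono hε hC (le_max_right _ _)
  let f : ℕ → Eu (m + 1) → ℝ≥0∞ := fun k u =>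
    ENNReal.ofReal (φ C - φ (suppFn (Km k) u - ⟪u, ξ k⟫))
  have hint := fun k => (hKm k).integrable_comp_suppFn_sub hμS hφ (hξm k)
  have hsub : ∀ k, Integrable (fun u => φ C - φ (suppFn (Km k) u - ⟪u, ξ k⟫)) μ := fun k =>
    (integrable_const _).sub (hint k)
  have hfint : ∀ᶠ k in atTop, ∫⁻ u, f k u ∂μ ≤ ENNReal.ofReal (μ.real univ * φ C - M) := by
    filter_upwards [hM, he.eventually (gt_mem_nhds one_pos)] with k hk hek
    simp only [f]
    rw [← ofReal_integral_eq_lintegral_ofReal (hsub k),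
      integral_sub (integrable_const _) (hint k), integral_const, smul_eq_mul]
    · exact ENNReal.ofReal_le_ofReal (sub_le_sub_left hk _)
    · filter_upwards [hμS] with u hu
      rw [mem_sphere_zero_iff_norm] at hu
      refine sub_nonneg.2 (hmono ((hKm k).suppFn_sub_pos (hξm k) hu) hC
        (le_trans ?_ (le_max_left _ _)))
      have h1 := abs_le.1 (hK.abs_suppFn_sub_sub_le (hKm k) (ξ k) x hu)
      linarith [h1.2, hC₀ u hu]
  have hfatou : ∫⁻ u, liminf (fun k => f k u) atTop ∂μ ≤
      ENNReal.ofReal (μ.real univ * φ C - M) :=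
    (lintegral_liminf_le' fun k =>
      (hsub k).aestronglyMeasurable.aemeasurable.ennreal_ofReal).trans
      (liminf_le_of_le (by isBoundedDefault) fun b hb => by
        obtain ⟨k, h1, h2⟩ := (hb.and hfint).exists
        exact h1.trans h2)
  have hlow : ∀ᵐ u ∂μ, ENNReal.ofReal (R * dist u v) ^ (-q) ≤
      liminf (fun k => f k u) atTop + ENNReal.ofReal (ε ^ (-q)) := by
    filter_upwards [hμS] with u hu
    rw [mem_sphere_zero_iff_norm] at hu
    have hstep : ∀ k, ENNReal.ofReal (R * dist u v + e k) ^ (-q) - ENNReal.ofReal (ε ^ (-q)) ≤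
        f k u := fun k => by
      have hpos := (hKm k).suppFn_sub_pos (hξm k) hu
      have hle : suppFn (Km k) u - ⟪u, ξ k⟫ ≤ R * dist u v + e k := by
        have h1 := abs_le.1 (hK.abs_suppFn_sub_sub_le (hKm k) (ξ k) x hu)
        linarith [h1.2, hgR u]
      have ht := hpos.trans_le hle
      rw [ENNReal.ofReal_rpow_of_pos ht, ← ENNReal.ofReal_sub _ (by positivity)]
      rcases le_total (R * dist u v + e k) ε with h | h
      · refine ENNReal.ofReal_le_ofReal ?_
        have h1 := hmono hpos ht hle
        rw [hφε _ ht h] at h1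
        linarith
      · rw [ENNReal.ofReal_of_nonpos]
        · exact zero_le
        · exact sub_nonpos.2 (Real.rpow_le_rpow_of_nonpos hε h (by linarith))
    have hlim : Tendsto (fun k => ENNReal.ofReal (R * dist u v + e k) ^ (-q) -
        ENNReal.ofReal (ε ^ (-q))) atTop
        (nhds (ENNReal.ofReal (R * dist u v) ^ (-q) - ENNReal.ofReal (ε ^ (-q)))) := by
      refine ENNReal.Tendsto.sub ?_ tendsto_const_nhds (Or.inr ENNReal.ofReal_ne_top)
      refine (ENNReal.continuous_rpow_const.tendsto _).comp (ENNReal.tendsto_ofReal ?_)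
      simpa using he.const_add (R * dist u v)
    rw [← tsub_le_iff_right, ← hlim.liminf_eq]
    exact liminf_le_liminf (Eventually.of_forall hstep)
  refine (lintegral_rpow_neg_dist_eq_top hc hR hq hmq hcμ).not_lt ?_
  refine (lintegral_mono_ae hlow).trans_lt ?_
  rw [lintegral_add_right _ measurable_const, lintegral_const]
  exact ENNReal.add_lt_top.2 ⟨hfatou.trans_lt ENNReal.ofReal_lt_top,
    ENNReal.mul_lt_top ENNReal.ofReal_lt_top (measure_lt_top _ _)⟩

/-- Lemma 3.5: both `K ↦ ξ(K)` and `K ↦ Φ_ε(K, ξ(K))` are continuous on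
the space of convex bodies with the Hausdorff metric (stated via sequences). -/
theorem optimal_center_continuous
    (n : ℕ) (p ε q τ₁ τ₂ : ℝ)
    (hp : -(n : ℝ) < p ∧ p < 1) (hε : ε ∈ Set.Ioo (0:ℝ) (1/3))
    (hq : q = max |p| ((n : ℝ) - 1))
    (φ : ℝ → ℝ) (hφ : IsPhiEps p ε q φ)
    (hτ : 0 < τ₁ ∧ τ₁ < τ₂)
    (f : Eu n → ℝ) (hf : ∀ u ∈ sphere (0 : Eu n) 1, τ₁ < f u ∧ f u < τ₂)
    (μ : Measure (Eu n))
    (hμ : μ = ((μH[(n:ℝ) - 1]).restrict (sphere (0 : Eu n) 1)).withDensity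
      (fun u => ENNReal.ofReal (f u)))
    (ξfun : Set (Eu n) → Eu n)
    (hξfun : ∀ K : Set (Eu n), IsConvexBody K → ξfun K ∈ interior K ∧
      ∀ η ∈ interior K, PhiE μ φ K η ≤ PhiE μ φ K (ξfun K)) :
    ∀ (Km : ℕ → Set (Eu n)) (K : Set (Eu n)), (∀ m, IsConvexBody (Km m)) →
      IsConvexBody K →
      Filter.Tendsto (fun m => Metric.hausdorffDist (Km m) K) Filter.atTop (nhds 0) →
      Filter.Tendsto (fun m => ξfun (Km m)) Filter.atTop (nhds (ξfun K)) ∧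
      Filter.Tendsto (fun m => PhiE μ φ (Km m) (ξfun (Km m))) Filter.atTop
        (nhds (PhiE μ φ K (ξfun K))) := by
  obtain ⟨hsm, hsc, hdiff, -, -, hφε, -⟩ := hφ
  have hφc : ContinuousOn φ (Ioi 0) := fun t ht =>
    (hdiff t ht).1.continuousAt.continuousWithinAt
  intro Km K hKm hK hd
  rcases n with _ | m
  · have hS : sphere (0 : Eu 0) 1 = ∅ := sphere_eq_empty_of_subsingleton one_ne_zero
    have hμ0 : μ = 0 := by simp [hμ, hS]
    simp only [PhiE, hμ0, integral_zero_measure, tendsto_const_nhds, and_true]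
    exact tendsto_const_nhds.congr fun _ => Subsingleton.elim _ _
  have hcast : ((m + 1 : ℕ) : ℝ) - 1 = m := by push_cast; ring
  rw [hcast] at hμ hq
  have hmq : (m : ℝ) ≤ q := hq ▸ le_max_right _ _
  have hq0 : 0 < q := by
    refine lt_of_le_of_ne (le_trans m.cast_nonneg hmq) fun h => ?_
    have h1 := hsm (half_pos hε.1) hε.1 (half_lt_self hε.1)
    rw [hφε _ (half_pos hε.1) (half_le_self hε.1.le), hφε _ hε.1 le_rfl, ← h] at h1
    simp at h1
  have hμS : ∀ᵐ u ∂μ, u ∈ sphere (0 : Eu (m + 1)) 1 := by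
    rw [hμ]
    exact (withDensity_absolutelyContinuous _ _).ae_le
      (ae_restrict_mem isClosed_sphere.measurableSet)
  have hμfin : IsFiniteMeasure μ := by
    rw [hμ]
    exact isFiniteMeasure_withDensity_sphere fun u hu => (hf u hu).2.le
  have hμlow : ∀ v : Eu (m + 1), ‖v‖ = 1 → ∃ c : ℝ, 0 < c ∧ ∀ r : ℝ, 0 ≤ r → r ≤ 1 →
      ENNReal.ofReal (c * r ^ m) ≤ μ (closedBall v r) := fun v hv => by
    rw [hμ]
    exact exists_le_withDensity_closedBall hτ.1 (fun u hu => (hf u hu).1.le) hv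
  have hμpos : ∀ v : Eu (m + 1), ‖v‖ = 1 → 0 < μ (closedBall v (1 / 2)) := fun v hv => by
    obtain ⟨c, hc, h⟩ := hμlow v hv
    exact lt_of_lt_of_le (ENNReal.ofReal_pos.2 (by positivity))
      (h (1 / 2) (by norm_num) (by norm_num))
  obtain ⟨hξK, hmax⟩ := hξfun K hK
  have hξ : Tendsto (fun k => ξfun (Km k)) atTop (nhds (ξfun K)) := by
    have hy : ∀ k, ∃ y ∈ K, dist (ξfun (Km k)) y < hausdorffDist (Km k) K + 1 / ((k : ℝ) + 1) :=
      fun k => exists_dist_lt_of_hausdorffDist_lt (interior_subset (hξfun _ (hKm k)).1)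
        (lt_add_of_pos_right _ Nat.one_div_pos_of_nat)
        (hausdorffEDist_ne_top_of_nonempty_of_bounded (hKm k).nonempty hK.nonempty
          (hKm k).2.1.isBounded hK.2.1.isBounded)
    choose y hyK hy using hy
    have hdist : Tendsto (fun k => dist (y k) (ξfun (Km k))) atTop (nhds 0) := by
      refine squeeze_zero (fun _ => dist_nonneg) (fun k => ?_)
        (by simpa only [add_zero] using hd.add tendsto_one_div_add_atTop_nhds_zero_nat)
      rw [dist_comm]
      exact (hy k).le
    refine tendsto_of_subseq_tendsto fun ns hns => ?_
    obtain ⟨x, hxK, ms, hms, hx⟩ := hK.2.1.tendsto_subseq fun k => hyK (ns k)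
    have hsub : Tendsto (fun k => ns (ms k)) atTop atTop := hns.comp hms.tendsto_atTop
    have hξx : Tendsto (fun k => ξfun (Km (ns (ms k)))) atTop (nhds x) :=
      tendsto_of_tendsto_of_dist hx (hdist.comp hsub)
    refine ⟨ms, ?_⟩
    have hKm' := fun k => hKm (ns (ms k))
    have hd' : Tendsto (fun k => hausdorffDist (Km (ns (ms k))) K) atTop (nhds 0) := hd.comp hsub
    obtain ⟨hint, hη⟩ := tendsto_PhiE hμS hφc hsm.monotoneOn hKm' hK hd' tendsto_const_nhds hξK
    have hle : ∀ᶠ k in atTop, PhiE μ φ (Km (ns (ms k))) (ξfun K) ≤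
        PhiE μ φ (Km (ns (ms k))) (ξfun (Km (ns (ms k)))) :=
      hint.mono fun k hk => (hξfun _ (hKm' k)).2 _ hk
    have hxi : x ∈ interior K := by
      refine mem_interior_of_tendsto_of_le_PhiE hμS hμlow hφc hsm.monotoneOn hε.1 hq0 hmq hφε
        hKm' hK hd' (fun k => (hξfun _ (hKm' k)).1) hξx hxK (M := PhiE μ φ K (ξfun K) - 1) ?_
      filter_upwards [hle, hη.eventually (lt_mem_nhds (sub_one_lt _))] with k h1 h2
      exact h2.le.trans h1
    have hlim := (tendsto_PhiE hμS hφc hsm.monotoneOn hKm' hK hd' hξx hxi).2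
    rwa [← eq_of_isMax_PhiE hμS hμpos hφc hsc hK hxi hξK (le_of_tendsto_of_tendsto hη hlim hle)
      hmax]
  exact ⟨hξ, (tendsto_PhiE hμS hφc hsm.monotoneOn hKm hK hd hξ hξK).2⟩

end
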